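/- For all n ≥ 1, the subgraph of the (2n+1)-dimensional hypercube Q_{2n+1} induced by all vertices with exactly n or n+1 ones has a Hamilton cycle. -/

import Mathlib

/-- The `m`-dimensional hypercube graph: vertices are bitstrings of length `m`,
with edges between bitstrings differing in exactly one bit. -/
def cubeGraph (m : ℕ) : SimpleGraph (Fin m → Bool) :=
  SimpleGraph.fromRel fun a b => hammingDist a b = 1

/-- The middle two levels of `Q_{2n+1}`: bitstrings with exactly `n` or `n+1` ones. -/
def middleLevels (n : ℕ) : Set (Fin (2 * n + 1) → Bool) :=
  {y | (Finset.univ.filter fun i => y i = true).card = n ∨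
       (Finset.univ.filter fun i => y i = true).card = n + 1}

/-- Plane trees with ordered children, encoded as binary trees (equivalently, Dyck words). -/
abbrev PT := BinaryTree Unit

namespace PT

/-- The tree whose Dyck word is `1 l 0 r`. -/
abbrev nd (l r : PT) : PT := BinaryTree.node () l r

/-- The empty tree. -/
abbrev em : PT := BinaryTree.nil

/-- Concatenation of Dyck words. -/
def app : PT → PT → PT
  | .nil, s => s
  | .node _ l r, s => nd l (app r s)

/-- The rotation `1 u 0 v ↦ u 1 v 0`. -/
def rot : PT → PT
  | .nil => em
  | .node _ l r => app l (nd r em)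

/-- The Dyck word of a tree. -/
def word : PT → List Bool
  | .nil => []
  | .node _ l r => true :: (word l ++ false :: word r)

/-- The sum of the depths. -/
def area : PT → ℕ
  | .nil => 0
  | .node _ l r => area l + l.numNodes + area r

@[simp] lemma app_em (t : PT) : app t em = t := by
  induction t with
  | nil => rfl
  | node a l r _ ih => cases a; simp [app, ih]

@[simp] lemma em_app (t : PT) : app em t = t := rfl

@[simp] lemma nd_app (l r s : PT) : app (nd l r) s = nd l (app r s) := rfl

@[simp] lemma rot_nd (l r : PT) : rot (nd l r) = app l (nd r em) := rfl

lemma app_assoc (a b c : PT) : app (app a b) c = app a (app b c) := by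
  induction a with
  | nil => rfl
  | node x l r _ ih => cases x; simp [ih]

@[simp] lemma numNodes_app (a b : PT) : (app a b).numNodes = a.numNodes + b.numNodes := by
  induction a with
  | nil => simp [BinaryTree.numNodes]
  | node x l r _ ih => cases x; simp [BinaryTree.numNodes, ih]; omega

@[simp] lemma numNodes_rot (t : PT) : (rot t).numNodes = t.numNodes := by
  cases t with
  | nil => rfl
  | node x l r => cases x; simp [BinaryTree.numNodes]; omega

lemma rot_app (u : PT) : ∀ v, rot^[2 * u.numNodes] (app u v) = app v u := by
  induction u with
  | nil => intro v; simp [BinaryTree.numNodes]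
  | node x a b iha ihb =>
    intro v
    cases x
    have : 2 * (BinaryTree.node () a b).numNodes
        = 2 * b.numNodes + (1 + (2 * a.numNodes + 1)) := by
      simp [BinaryTree.numNodes]; ring
    rw [this, Function.iterate_add_apply, Function.iterate_add_apply, Function.iterate_add_apply]
    simp only [Function.iterate_one, nd_app, rot_nd]
    rw [iha, nd_app, em_app, rot_nd, app_assoc, ihb, app_assoc, nd_app, em_app]

lemma rot_period (t : PT) : rot^[2 * t.numNodes] t = t := by
  simpa using rot_app t em

/-- Pulling a leaf towards the root, somewhere in the tree. -/
inductive Pull : PT → PT → Prop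
  | base (u v : PT) : Pull (nd (nd em u) v) (nd em (nd u v))
  | left (l l' v : PT) : Pull l l' → Pull (nd l v) (nd l' v)
  | right (l v v' : PT) : Pull v v' → Pull (nd l v) (nd l v')

lemma Pull.numNodes {t t' : PT} (h : Pull t t') : t'.numNodes = t.numNodes := by
  induction h <;> simp_all [BinaryTree.numNodes]
  omega

lemma Pull.area_lt {t t' : PT} (h : Pull t t') : area t' < area t := by
  induction h with
  | base u v => simp [area, BinaryTree.numNodes]
  | left l l' v h ih => have := h.numNodes; simp [area]; omega
  | right l v v' h ih => simp [area]; omega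

lemma exists_pull (t : PT) (h : 0 < area t) : ∃ t', Pull t t' := by
  induction t with
  | nil => simp [area] at h
  | node x l r ihl ihr =>
    cases x
    match l with
    | .nil =>
      obtain ⟨t', ht⟩ := ihr (by simpa [area, BinaryTree.numNodes] using h)
      exact ⟨_, .right _ _ _ ht⟩
    | .node () .nil u => exact ⟨_, .base u r⟩
    | .node () (.node () a b) u =>
      obtain ⟨t', ht⟩ := ihl (by simp [area, BinaryTree.numNodes])
      exact ⟨_, .left _ _ _ ht⟩

lemma Pull.rotates {t t' : PT} (h : Pull t t') : ∀ s, ∃ k u v,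
    rot^[k] (app t s) = nd (nd em u) v ∧ rot^[k] (app t' s) = nd em (nd u v) := by
  induction h with
  | base u v => intro s; exact ⟨0, u, app v s, rfl, rfl⟩
  | left l l' v h ih =>
    intro s
    obtain ⟨k, u, w, h1, h2⟩ := ih (nd (app v s) em)
    exact ⟨k + 1, u, w, h1, h2⟩
  | right l v v' h ih =>
    intro s
    obtain ⟨k, u, w, h1, h2⟩ := ih (app s (nd l em))
    refine ⟨k + 2 * (nd l em).numNodes, u, w, ?_, ?_⟩
    · rw [Function.iterate_add_apply, ← h1, ← app_assoc, ← rot_app (nd l em)]; rfl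
    · rw [Function.iterate_add_apply, ← h2, ← app_assoc, ← rot_app (nd l em)]; rfl

/-- The star. -/
def star : ℕ → PT
  | 0 => em
  | n + 1 => nd em (star n)

lemma numNodes_star (n : ℕ) : (star n).numNodes = n := by
  induction n with
  | zero => rfl
  | succ n ih => simp [star, BinaryTree.numNodes, ih]

lemma eq_star (t : PT) (h : area t = 0) : t = star t.numNodes := by
  induction t with
  | nil => rfl
  | node x l r _ ih =>
    cases x
    simp only [area] at h
    match l with
    | .nil =>
      have := ih (by omega)
      simp only [BinaryTree.numNodes, zero_add, star]
      rw [← this]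
    | .node _ _ _ => simp [BinaryTree.numNodes] at h

@[simp] lemma word_app (a b : PT) : word (app a b) = word a ++ word b := by
  induction a with
  | nil => rfl
  | node x l r _ ih => cases x; simp [word, ih]

lemma length_word (t : PT) : (word t).length = 2 * t.numNodes := by
  induction t with
  | nil => rfl
  | node x l r h1 h2 => simp [word, BinaryTree.numNodes, h1, h2]; ring

lemma count_word (t : PT) : (word t).count true = t.numNodes := by
  induction t with
  | nil => rfl
  | node x l r h1 h2 => simp [word, BinaryTree.numNodes, h1, h2]

/-- Height reached by a lattice path. -/
def ht (l : List Bool) : ℤ := (l.map fun b => if b then (1 : ℤ) else -1).sum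

@[simp] lemma ht_nil : ht [] = 0 := rfl
@[simp] lemma ht_cons (b : Bool) (l : List Bool) :
    ht (b :: l) = (if b then (1 : ℤ) else -1) + ht l := by simp [ht]
@[simp] lemma ht_append (a b : List Bool) : ht (a ++ b) = ht a + ht b := by simp [ht]

@[simp] lemma ht_word (t : PT) : ht (word t) = 0 := by
  induction t with
  | nil => rfl
  | node x l r h1 h2 => simp [word, h1, h2]

lemma ht_take (t : PT) : ∀ k, 0 ≤ ht ((word t).take k) := by
  induction t with
  | nil => simp [word]
  | node x l r h1 h2 =>
    intro k
    cases k with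
    | zero => simp
    | succ k =>
      simp only [word, List.take_succ_cons, List.take_append, ht_cons, ht_append, if_true]
      have := h1 k
      rcases hk : k - (word l).length with _ | j
      · simp; omega
      · rw [List.take_of_length_le (by omega)]
        have := h2 j
        simp; omega

lemma ht_start (t : PT) {p q : List Bool} (h : word t = p ++ q) : 0 ≤ ht p := by
  have := ht_take t p.length
  rwa [h, List.take_left] at this

lemma word_append_false_inj (t : PT) : ∀ t' r r', word t ++ false :: r = word t' ++ false :: r' →
    t = t' ∧ r = r' := by
  have key : ∀ (t t' : PT) (r r' : List Bool), word t ++ false :: r = word t' ++ false :: r' →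
      (word t).length = (word t').length := by
    have key1 : ∀ (t t' : PT) (r r' : List Bool), word t ++ false :: r = word t' ++ false :: r' →
      ¬ (word t).length < (word t').length := by
      intro t t' r r' h hl
      have h2 := congrArg (List.take ((word t).length + 1)) h
      have h3 := ht_take t' ((word t).length + 1)
      rw [List.take_append_of_le_length (by omega : _ ≤ (word t').length)] at h2
      rw [← h2] at h3
      rw [List.take_append, List.take_of_length_le (by omega)] at h3
      simp at h3
    intro t t' r r' h
    have := key1 t t' r r' h
    have := key1 t' t r' r h.symm
    omega
  induction t with
  | nil =>
    intro t' r r' h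
    cases t' with
    | nil => simpa [word] using h
    | node x l' s' => simp [word] at h
  | node x l s ihl ihs =>
    intro t' r r' h
    cases t' with
    | nil => simp [word] at h
    | node x' l' s' =>
      simp only [word, List.cons_append, List.append_assoc, List.cons.injEq, true_and] at h
      obtain ⟨h1, h2⟩ := ihl _ _ _ h
      obtain ⟨h3, h4⟩ := ihs _ _ _ h2
      exact ⟨by rw [h1, h3], h4⟩

lemma word_inj {t t' : PT} (h : word t = word t') : t = t' :=
  (word_append_false_inj t t' [] [] (by rw [h])).1

/-- A balanced nonempty prefix of a Dyck word ends with 0. -/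
lemma start_end (t : PT) {p q : List Bool} (h : word t = (p ++ [true]) ++ q) : 0 < ht (p ++ [true]) := by
  have : 0 ≤ ht p := ht_start t (q := true :: q) (by simpa using h)
  simp; omega

end PT

namespace PT

lemma shift_unique (b : Bool) (t t' : PT) (p q : List Bool) (hp : p ≠ []) (hq : q ≠ [])
    (h : word t ++ [b] = q ++ p) (h' : word t' ++ [b] = p ++ q) : False := by
  obtain ⟨p0, c, rfl⟩ := List.eq_nil_or_concat p |>.resolve_left hp
  obtain ⟨q0, d, rfl⟩ := List.eq_nil_or_concat q |>.resolve_left hq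
  simp only [List.concat_eq_append] at h h'
  rw [← List.append_assoc] at h h'
  obtain ⟨h1, h2⟩ := List.append_inj' h rfl
  obtain ⟨h3, h4⟩ := List.append_inj' h' rfl
  simp only [List.cons.injEq, and_true] at h2 h4
  subst h2 h4
  have e := congrArg ht h
  cases b with
  | true =>
    have a1 := start_end t h1
    have a2 := start_end t' h3
    simp at e a1 a2
    omega
  | false =>
    have a1 := ht_start t h1
    have a2 := ht_start t' h3
    simp at e a1 a2
    omega

end PT

/-- The bitstring obtained from the list `w` by shifting it cyclically by `i`. -/
def shiftWord (n : ℕ) (w : List Bool) (i : Fin (2 * n + 1)) : Fin (2 * n + 1) → Bool :=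
  fun j => w.getD (j - i).val false

lemma shiftWord_succ (n : ℕ) (w : List Bool) (c : Bool) (hw : w.length = 2 * n)
    (i : Fin (2 * n + 1)) : shiftWord n (w ++ [c]) (i + 1) = shiftWord n (c :: w) i := by
  funext j
  unfold shiftWord
  have : j - (i + 1) = (j - i) - 1 := by abel
  rw [this]
  generalize j - i = k
  rcases Nat.eq_zero_or_pos n with rfl | hn
  · have : w = [] := List.length_eq_zero_iff.1 (by simpa using hw)
    subst this
    have : k = 0 := Fin.ext (by have := k.isLt; simp)
    subst this
    rfl
  by_cases hk : k = 0
  · subst hk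
    have : (0 - 1 : Fin (2 * n + 1)).val = 2 * n := by
      rw [zero_sub, Fin.coe_neg_one]
    rw [this]
    simp [List.getD_eq_getElem?_getD, ← hw]
  · have h1 : k.val ≠ 0 := fun h => hk (Fin.ext h)
    have : (k - 1).val = k.val - 1 := by
      rw [Fin.val_sub_one_of_ne_zero hk]
    rw [this]
    obtain ⟨j, hj⟩ := Nat.exists_eq_succ_of_ne_zero h1
    have := k.isLt
    rw [hj]
    simp [List.getD_eq_getElem?_getD]
    rw [List.getElem?_append_left (by omega)]

lemma shiftWord_adj (n : ℕ) (p q : List Bool) (h : p.length + q.length = 2 * n)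
    (i : Fin (2 * n + 1)) (b c : Bool) (hbc : b ≠ c) :
    (cubeGraph (2 * n + 1)).Adj (shiftWord n (p ++ b :: q) i) (shiftWord n (p ++ c :: q) i) := by
  have hd : hammingDist (shiftWord n (p ++ b :: q) i) (shiftWord n (p ++ c :: q) i) = 1 := by
    unfold hammingDist
    rw [Finset.card_eq_one]
    refine ⟨i + ⟨p.length, by omega⟩, ?_⟩
    ext j
    rw [Finset.mem_filter, Finset.mem_singleton]
    simp only [Finset.mem_univ, true_and, shiftWord]
    rw [show (j = i + ⟨p.length, by omega⟩) ↔ (j - i = (⟨p.length, by omega⟩ : Fin (2 * n + 1))) by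
      rw [sub_eq_iff_eq_add, add_comm i]]
    generalize j - i = k
    rw [Fin.ext_iff]
    simp only [List.getD_eq_getElem?_getD]
    constructor
    · intro hne
      by_contra hk
      apply hne
      rcases lt_or_gt_of_ne hk with hlt | hlt
      · rw [List.getElem?_append_left hlt, List.getElem?_append_left hlt]
      · rw [List.getElem?_append_right hlt.le, List.getElem?_append_right hlt.le]
        obtain ⟨r, hr⟩ := Nat.exists_eq_succ_of_ne_zero (Nat.sub_ne_zero_of_lt hlt)
        rw [hr]; simp
    · intro hk
      rw [hk]
      simpa using hbc
  rw [cubeGraph, SimpleGraph.fromRel_adj]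
  refine ⟨fun he => ?_, Or.inl hd⟩
  rw [he, hammingDist_self] at hd
  omega

lemma shiftWord_rotate (n : ℕ) (w w' : List Bool) (hw : w.length = 2 * n + 1)
    (hw' : w'.length = 2 * n + 1) (i i' : Fin (2 * n + 1))
    (h : shiftWord n w i = shiftWord n w' i') : w = w'.rotate (i - i').val := by
  apply List.ext_getElem
  · simp [hw, hw']
  · intro k h1 h2
    rw [List.getElem_rotate]
    have := congrFun h (⟨k, by omega⟩ + i)
    unfold shiftWord at this
    rw [add_sub_cancel_right, add_sub_assoc] at this
    have e : ((⟨k, by omega⟩ : Fin (2 * n + 1)) + (i - i')).val = (k + (i - i').val) % w'.length := by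
      rw [Fin.val_add, hw']
    rw [e] at this
    rwa [List.getD_eq_getElem _ _ h1, List.getD_eq_getElem _ _ (by rw [hw']; exact Nat.mod_lt _ (by omega))] at this

lemma shiftWord_weight (n : ℕ) (w : List Bool) (hw : w.length = 2 * n + 1)
    (i : Fin (2 * n + 1)) :
    (Finset.univ.filter fun j => shiftWord n w i j = true).card = w.count true := by
  have : (Finset.univ.filter fun j => shiftWord n w i j = true).card
      = (Finset.univ.filter fun j : Fin (2 * n + 1) => w.get (j.cast hw.symm) = true).card := by
    refine Finset.card_bij (fun j _ => j - i) ?_ ?_ ?_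
    · intro j hj
      rw [Finset.mem_filter] at hj ⊢
      simp only [Finset.mem_univ, true_and, shiftWord] at hj ⊢
      rw [List.getD_eq_getElem _ _ (by omega)] at hj
      simpa using hj
    · intro a _ b _ h
      exact sub_left_injective h
    · intro j hj
      refine ⟨j + i, ?_, by simp⟩
      rw [Finset.mem_filter] at hj ⊢
      simp only [Finset.mem_univ, true_and, shiftWord] at hj ⊢
      rw [add_sub_cancel_right, List.getD_eq_getElem _ _ (by omega)]
      simpa using hj
  rw [this]
  exact Fin.card_filter_univ_eq_vector_get_eq_count true (⟨w, hw⟩ : List.Vector Bool _)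

open PT

/-- States: a tree and a shift. -/
abbrev Sta (n : ℕ) := PT × Fin (2 * n + 1)

/-- The bitstring of a state with final bit. -/
def rea (n : ℕ) (p : Sta n × Bool) : Fin (2 * n + 1) → Bool :=
  shiftWord n (word p.1.1 ++ [p.2]) p.1.2

lemma rea_weight (n : ℕ) (p : Sta n × Bool) (hp : p.1.1.numNodes = n) :
    (Finset.univ.filter fun j => rea n p j = true).card = n + p.2.toNat := by
  unfold rea
  rw [shiftWord_weight _ _ (by simp [length_word, hp])]
  rcases p with ⟨⟨t, i⟩, b⟩
  cases b <;> simp_all [count_word]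

lemma rea_mem (n : ℕ) (p : Sta n × Bool) (hp : p.1.1.numNodes = n) :
    rea n p ∈ middleLevels n := by
  have := rea_weight n p hp
  rcases p with ⟨⟨t, i⟩, b⟩
  cases b
  · left; simpa using this
  · right; simpa using this

lemma rea_inj (n : ℕ) (p q : Sta n × Bool) (hp : p.1.1.numNodes = n) (hq : q.1.1.numNodes = n)
    (h : rea n p = rea n q) : p = q := by
  have h1 := rea_weight n p hp
  have h2 := rea_weight n q hq
  rw [h] at h1
  rcases p with ⟨⟨t, i⟩, b⟩
  rcases q with ⟨⟨t', i'⟩, b'⟩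
  have hb : b = b' := by
    cases b <;> cases b' <;> simp_all
  subst hb
  simp only at hp hq
  have hr := shiftWord_rotate n _ _ (by simp [length_word, hp]) (by simp [length_word, hq]) _ _ h
  simp only at hr
  by_cases hi : i = i'
  · subst hi
    simp at hr
    rw [word_inj hr]
  exfalso
  set k := i - i' with hk
  have hk0 : k.val ≠ 0 := fun h0 => hi (sub_eq_zero.1 (Fin.ext h0 : k = 0))
  have hl : (word t' ++ [b]).length = 2 * n + 1 := by simp [length_word, hq]
  have hk1 := k.isLt
  rw [List.rotate_eq_drop_append_take (by omega)] at hr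
  refine shift_unique b t t' ((word t' ++ [b]).take k) ((word t' ++ [b]).drop k) ?_ ?_ hr
    (List.take_append_drop _ _).symm
  · intro h0
    have := congrArg List.length h0
    rw [List.length_take, hl, List.length_nil] at this
    omega
  · intro h0
    have := congrArg List.length h0
    rw [List.length_drop, hl, List.length_nil] at this
    omega

/-- Two states with bits whose bitstrings are neighbours in the cube. -/
def AdjS (n : ℕ) (p q : Sta n × Bool) : Prop := (cubeGraph (2 * n + 1)).Adj (rea n p) (rea n q)

lemma AdjS.symm {n : ℕ} {p q : Sta n × Bool} (h : AdjS n p q) : AdjS n q p :=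
  SimpleGraph.Adj.symm h

/-- The successor state. -/
def nxt (n : ℕ) (z : Sta n) : Sta n := (rot z.1, z.2 + 1)

lemma adj_one (n : ℕ) (z : Sta n) (hz : z.1.numNodes = n) : AdjS n (z, true) (z, false) :=
  shiftWord_adj n (word z.1) [] (by simp [length_word, hz]) z.2 true false (by simp)

lemma adj_two (n : ℕ) (hn : 1 ≤ n) (z : Sta n) (hz : z.1.numNodes = n) :
    AdjS n (z, false) (nxt n z, true) := by
  rcases z with ⟨t, i⟩
  cases t with
  | nil => simp [BinaryTree.numNodes] at hz; omega
  | node x u v =>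
    cases x
    simp only [BinaryTree.numNodes] at hz
    unfold AdjS rea nxt
    simp only [rot_nd, word_app]
    rw [shiftWord_succ _ _ _ (by simp [word, length_word]; omega)]
    have := shiftWord_adj n (true :: word u) (word v ++ [false])
      (by simp [length_word]; omega) i false true (by simp)
    simpa [word] using this

lemma adj_ga (n : ℕ) (u v : PT) (i : Fin (2 * n + 1)) (h : (nd (nd em u) v).numNodes = n) :
    AdjS n ((nd (nd em u) v, i), false) (nxt n (nd em (nd u v), i), true) := by
  simp only [BinaryTree.numNodes] at h
  unfold AdjS rea nxt
  simp only [rot_nd, em_app]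
  rw [shiftWord_succ _ _ _ (by simp [word, length_word]; omega)]
  have := shiftWord_adj n [true, true] (word u ++ false :: word v ++ [false])
    (by simp [length_word]; omega) i false true (by simp)
  simpa [word] using this

lemma adj_bc (n : ℕ) (u v : PT) (i : Fin (2 * n + 1)) (h : (nd (nd em u) v).numNodes = n) :
    AdjS n (nxt n (nd (nd em u) v, i), true) (nxt n (nxt n (nxt n (nd (nd em u) v, i))), false) := by
  simp only [BinaryTree.numNodes] at h
  unfold AdjS rea nxt
  simp only [rot_nd, em_app, nd_app, word_app]
  rw [shiftWord_succ _ _ _ (by simp [word, length_word]; omega),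
    shiftWord_succ _ _ _ (by simp [word, length_word]; omega)]
  have e : false :: (word u ++ word (nd v em) ++ word (nd em em))
      = (false :: (word u ++ word (nd v em) ++ [true])) ++ [false] := by simp [word]
  rw [e, shiftWord_succ _ _ _ (by simp [word, length_word]; omega)]
  have e : false :: false :: (word u ++ word (nd v em) ++ [true])
      = (false :: false :: (word u ++ word (nd v em))) ++ [true] := by simp
  rw [e, shiftWord_succ _ _ _ (by simp [word, length_word]; omega)]
  have := shiftWord_adj n [true] (false :: word u ++ true :: word v ++ [false])
    (by simp [length_word]; omega) i true false (by simp)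
  simpa [word] using this

lemma adj_de (n : ℕ) (u v : PT) (i : Fin (2 * n + 1)) (h : (nd (nd em u) v).numNodes = n) :
    AdjS n ((nd em (nd u v), i), false) (nxt n (nxt n (nxt n (nd (nd em u) v, i))), true) := by
  simp only [BinaryTree.numNodes] at h
  unfold AdjS rea nxt
  simp only [rot_nd, em_app, nd_app, word_app]
  rw [shiftWord_succ _ _ _ (by simp [word, length_word]; omega)]
  have e : true :: (word u ++ word (nd v em) ++ word (nd em em))
      = (true :: (word u ++ word (nd v em) ++ [true])) ++ [false] := by simp [word]
  rw [e, shiftWord_succ _ _ _ (by simp [word, length_word]; omega)]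
  have e : false :: true :: (word u ++ word (nd v em) ++ [true])
      = (false :: true :: (word u ++ word (nd v em))) ++ [true] := by simp
  rw [e, shiftWord_succ _ _ _ (by simp [word, length_word]; omega)]
  have := shiftWord_adj n (true :: false :: true :: word u) (word v ++ [false])
    (by simp [length_word]; omega) i false true (by simp)
  simpa [word] using this

lemma card_weight_le (m k : ℕ) :
    (Finset.univ.filter fun y : Fin m → Bool =>
      (Finset.univ.filter fun i => y i = true).card = k).card ≤ m.choose k := by
  have : m.choose k = (Finset.powersetCard k (Finset.univ : Finset (Fin m))).card := by simp
  rw [this]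
  refine Finset.card_le_card_of_injOn (fun y => Finset.univ.filter fun i => y i = true) ?_ ?_
  · intro y hy
    simpa [Finset.mem_powersetCard] using hy
  · intro y _ y' _ h
    funext i
    have := congrArg (fun s => i ∈ s) h
    simp only [Finset.mem_filter, Finset.mem_univ, true_and, eq_iff_iff] at this
    exact Bool.eq_iff_iff.2 this

lemma choose_catalan (n : ℕ) :
    (2 * n + 1).choose n + (2 * n + 1).choose (n + 1) = catalan n * (2 * n + 1) * 2 := by
  have h1 := succ_mul_catalan_eq_centralBinom n
  have h2 := Nat.add_one_mul_choose_eq (2 * n) n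
  have h3 := Nat.choose_symm_half n
  have : (n + 1) * (2 * n + 1).choose (n + 1) = (n + 1) * (catalan n * (2 * n + 1)) := by
    rw [Nat.centralBinom] at h1
    rw [← h1] at h2
    linarith
  have := Nat.eq_of_mul_eq_mul_left (Nat.succ_pos n) this
  omega

lemma rea_surj (n : ℕ) (y : Fin (2 * n + 1) → Bool) (hy : y ∈ middleLevels n) :
    ∃ p : Sta n × Bool, p.1.1.numNodes = n ∧ rea n p = y := by
  classical
  set A : Finset (Sta n × Bool) :=
    (BinaryTree.treesOfNumNodesEq n ×ˢ Finset.univ) ×ˢ Finset.univ with hA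
  have hmem : ∀ p : Sta n × Bool, p ∈ A ↔ p.1.1.numNodes = n := by
    intro p; simp [hA, BinaryTree.mem_treesOfNumNodesEq]
  set B : Finset (Fin (2 * n + 1) → Bool) :=
    (Finset.univ.filter fun y => (Finset.univ.filter fun i => y i = true).card = n) ∪
    (Finset.univ.filter fun y => (Finset.univ.filter fun i => y i = true).card = n + 1) with hB
  have hmB : ∀ y, y ∈ B ↔ y ∈ middleLevels n := by
    intro y; simp [hB, middleLevels]
  have hcA : A.card = catalan n * (2 * n + 1) * 2 := by
    simp [hA, BinaryTree.treesOfNumNodesEq_card_eq_catalan]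
  have hcB : B.card ≤ catalan n * (2 * n + 1) * 2 := by
    rw [← choose_catalan]
    exact (Finset.card_union_le _ _).trans
      (Nat.add_le_add (card_weight_le _ _) (card_weight_le _ _))
  have hsub : A.image (rea n) ⊆ B := by
    intro z hz
    obtain ⟨p, hp, rfl⟩ := Finset.mem_image.1 hz
    exact (hmB _).2 (rea_mem n p ((hmem p).1 hp))
  have hcI : (A.image (rea n)).card = A.card := by
    apply Finset.card_image_of_injOn
    intro p hp q hq h
    exact rea_inj n p q ((hmem p).1 hp) ((hmem q).1 hq) h
  have heq := Finset.eq_of_subset_of_card_le hsub (by omega)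
  have : y ∈ A.image (rea n) := by rw [heq]; exact (hmB y).2 hy
  obtain ⟨p, hp, h⟩ := Finset.mem_image.1 this
  exact ⟨p, (hmem p).1 hp, h⟩

/-! ### Lists -/

/-- `p` and `q` are consecutive in `l`, in one of the two orders. -/
def Near {X : Type*} (l : List X) (p q : X) : Prop := [p, q] <:+: l ∨ [q, p] <:+: l

section lists

variable {X : Type*}

lemma Near.swap {l : List X} {p q : X} (h : Near l p q) : Near l q p := Or.symm h

lemma Near.mono {l l' : List X} {p q : X} (h : Near l p q) (hl : l <:+: l') : Near l' p q :=
  h.imp (fun h => h.trans hl) (fun h => h.trans hl)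

lemma Near.reverse {l : List X} {p q : X} (h : Near l p q) : Near l.reverse p q := by
  rcases h with h | h
  · right; simpa using List.reverse_infix.2 h
  · left; simpa using List.reverse_infix.2 h

lemma pair_split {a b : List X} {x y p q : X} (h : [p, q] <:+: a ++ x :: y :: b) :
    [p, q] <:+: a ++ [x] ∨ (p = x ∧ q = y) ∨ [p, q] <:+: y :: b := by
  obtain ⟨s, t, h⟩ := h
  have h' : (s ++ [p]) ++ q :: t = (a ++ [x]) ++ y :: b := by simpa using h
  rcases List.append_eq_append_iff.1 h' with ⟨r, h1, h2⟩ | ⟨r, h1, h2⟩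
  · rcases r with _ | ⟨c, r⟩
    · simp only [List.append_nil] at h1
      have := List.append_inj' h1 rfl
      simp at this h2
      exact Or.inr (Or.inl ⟨this.2.symm, h2.1⟩)
    · simp only [List.cons_append, List.cons.injEq] at h2
      left
      exact ⟨s, r, by rw [h1, h2.1]; simp⟩
  · rcases List.eq_nil_or_concat r with rfl | ⟨r', c, rfl⟩
    · simp only [List.append_nil] at h1
      have := List.append_inj' h1 rfl
      simp at this h2
      exact Or.inr (Or.inl ⟨this.2, h2.1.symm⟩)
    · right; right
      simp only [List.concat_eq_append, ← List.append_assoc] at h1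
      have := List.append_inj' h1 rfl
      simp at this
      refine ⟨r', t, ?_⟩
      rw [h2, this.2]; simp

lemma insert_aux {r : X → X → Prop} {l1 l2 R : List X} {x y : X}
    (hl : (l1 ++ x :: y :: l2).IsChain r) (hR : R.IsChain r) (hne : R ≠ [])
    (hx : ∀ d ∈ R.head?, r x d) (hy : ∀ a ∈ R.getLast?, r a y) :
    (l1 ++ x :: (R ++ y :: l2)).IsChain r := by
  have h1 : (l1 ++ [x]).IsChain r := (List.isChain_split.1 hl).1
  have h2 : (y :: l2).IsChain r := (List.isChain_cons_cons.1 (List.isChain_split.1 hl).2).2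
  have h3 : (R ++ y :: l2).IsChain r := by
    rw [List.isChain_append]
    exact ⟨hR, h2, fun a ha b hb => by simp at hb; subst hb; exact hy a ha⟩
  have : ((l1 ++ [x]) ++ (R ++ y :: l2)).IsChain r := by
    rw [List.isChain_append]
    refine ⟨h1, h3, fun a ha b hb => ?_⟩
    simp at ha
    subst ha
    apply hx
    cases R with
    | nil => exact absurd rfl hne
    | cons c R => simpa using hb
  simpa using this

/-- Insert the list `R` between the consecutive elements `e`, `g` of `l`. -/
lemma insert_list {r : X → X → Prop} (hs : ∀ {a b}, r a b → r b a) {l R : List X} {e g d a : X}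
    (hl : l.IsChain r) (hR : R.IsChain r) (hd : R.head? = some d) (ha : R.getLast? = some a)
    (hed : r e d) (hag : r a g) (hn : Near l e g) :
    ∃ l', l'.Perm (l ++ R) ∧ l'.IsChain r ∧ l'.head? = l.head? ∧ l'.getLast? = l.getLast? ∧
      (∀ p q, Near l p q → p ≠ e → p ≠ g → Near l' p q) ∧ (∀ p q, Near R p q → Near l' p q) := by
  have hne : R ≠ [] := by rintro rfl; simp at hd
  -- the common construction
  have main : ∀ (x y : X) (R : List X) (l1 l2 : List X), l = l1 ++ x :: y :: l2 → R.IsChain r →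
      R ≠ [] → (∀ d ∈ R.head?, r x d) → (∀ a ∈ R.getLast?, r a y) →
      ∃ l', l'.Perm (l ++ R) ∧ l'.IsChain r ∧ l'.head? = l.head? ∧ l'.getLast? = l.getLast? ∧
      (∀ p q, Near l p q → p ≠ x → p ≠ y → Near l' p q) ∧ (∀ p q, Near R p q → Near l' p q) := by
    rintro x y R l1 l2 rfl hR hne hx hy
    refine ⟨l1 ++ x :: (R ++ y :: l2), ?_, insert_aux hl hR hne hx hy, ?_, ?_, ?_, ?_⟩
    · rw [List.append_assoc]
      apply List.Perm.append_left
      simp only [List.cons_append]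
      apply List.Perm.cons
      exact List.perm_append_comm
    · cases l1 <;> simp
    · have e1 : l1 ++ x :: (R ++ y :: l2) = (l1 ++ x :: R) ++ y :: l2 := by simp
      have e2 : l1 ++ x :: y :: l2 = (l1 ++ [x]) ++ y :: l2 := by simp
      rw [e1, e2, List.getLast?_append, List.getLast?_append]
      simp [List.getLast?_cons]
    · have hA : (l1 ++ [x]) <:+: l1 ++ x :: (R ++ y :: l2) := ⟨[], R ++ y :: l2, by simp⟩
      have hB : (y :: l2) <:+: l1 ++ x :: (R ++ y :: l2) := ⟨l1 ++ x :: R, [], by simp⟩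
      intro p q h hpx hpy
      rcases h with h | h
      · rcases pair_split h with h | h | h
        · exact Or.inl (h.trans hA)
        · exact absurd h.1 hpx
        · exact Or.inl (h.trans hB)
      · rcases pair_split h with h | h | h
        · exact Or.inr (h.trans hA)
        · exact absurd h.2 hpy
        · exact Or.inr (h.trans hB)
    · intro p q h
      exact h.mono ⟨l1 ++ [x], y :: l2, by simp⟩
  rcases hn with ⟨l1, l2, h⟩ | ⟨l1, l2, h⟩
  · exact main e g R l1 l2 (by rw [← h]; simp) hR hne
      (by rw [hd]; intro c hc; simp at hc; subst hc; exact hed)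
      (by rw [ha]; intro c hc; simp at hc; subst hc; exact hag)
  · obtain ⟨l', h1, h2, h3, h4, h5, h6⟩ := main g e R.reverse l1 l2 (by rw [← h]; simp)
      (by rw [List.isChain_reverse]; exact hR.imp fun a b => hs) (by simpa using hne)
      (by rw [List.head?_reverse, ha]; intro c hc; simp at hc; subst hc; exact hs hag)
      (by rw [List.getLast?_reverse, hd]; intro c hc; simp at hc; subst hc; exact hs hed)
    refine ⟨l', h1.trans (List.Perm.append_left _ (List.reverse_perm R)), h2, h3, h4, ?_, ?_⟩
    · intro p q h he hg
      exact h5 p q h hg he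
    · intro p q h
      exact h6 p q h.reverse

/-- Replace each state by its two bitstrings. -/
def dbl {W : Type*} (O : List W) : List (W × Bool) := O.flatMap fun z => [(z, true), (z, false)]

variable {W : Type*}

@[simp] lemma dbl_nil : dbl ([] : List W) = [] := rfl
@[simp] lemma dbl_cons (z : W) (O : List W) :
    dbl (z :: O) = (z, true) :: (z, false) :: dbl O := rfl
@[simp] lemma dbl_append (O O' : List W) : dbl (O ++ O') = dbl O ++ dbl O' := by simp [dbl]

lemma mem_dbl (O : List W) (p : W × Bool) : p ∈ dbl O ↔ p.1 ∈ O := by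
  rcases p with ⟨z, b⟩
  cases b <;> simp [dbl]

lemma nodup_dbl (O : List W) (h : O.Nodup) : (dbl O).Nodup := by
  induction O with
  | nil => simp
  | cons z O ih =>
    rw [List.nodup_cons] at h
    simp [mem_dbl, h.1, ih h.2]

lemma chain_dbl {r : W × Bool → W × Bool → Prop} {F : W → W} (O : List W)
    (hO : O.IsChain fun a b => b = F a) (h1 : ∀ z ∈ O, r (z, true) (z, false))
    (h2 : ∀ z ∈ O, r (z, false) (F z, true)) : (dbl O).IsChain r := by
  induction O with
  | nil => simp
  | cons z O ih =>
    have := ih hO.of_cons (fun w hw => h1 w (by simp [hw])) (fun w hw => h2 w (by simp [hw]))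
    cases O with
    | nil => simpa using h1 z (by simp)
    | cons y O =>
      simp only [List.isChain_cons_cons] at hO
      simp only [dbl_cons, List.isChain_cons_cons] at this ⊢
      refine ⟨h1 z (by simp), ?_, this⟩
      rw [hO.1]
      exact h2 z (by simp)

lemma near_dbl {F : W → W} (O : List W) (hO : O.IsChain fun a b => b = F a) (z : W) (hz : z ∈ O)
    (hl : O.getLast? ≠ some z) : [(z, false), (F z, true)] <:+: dbl O := by
  obtain ⟨A, B, rfl⟩ := List.append_of_mem hz
  cases B with
  | nil => simp at hl
  | cons y B =>
    have : y = F z := by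
      have := (List.isChain_split.1 hO).2
      exact (List.isChain_cons_cons.1 this).1
    subst this
    exact ⟨dbl A ++ [(z, true)], (F z, false) :: dbl B, by simp⟩

/-- The list `F w, F (F w), …, w`. -/
noncomputable def orb (F : W → W) (w : W) : List W :=
  (List.range (Function.minimalPeriod F w)).map fun k => F^[k + 1] w

variable (F : W → W) (w : W)

lemma orb_chain : (orb F w).IsChain fun a b => b = F a := by
  unfold orb
  rw [List.isChain_map]
  rw [List.isChain_iff_getElem]
  intro i hi
  simp only [List.getElem_range]
  exact Function.iterate_succ_apply' F _ w

lemma orb_nodup : (orb F w).Nodup := by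
  unfold orb
  rw [List.nodup_map_iff_inj_on List.nodup_range]
  intro a ha b hb hab
  rw [List.mem_range] at ha hb
  have hw : w ∈ Function.periodicPts F :=
    Function.minimalPeriod_pos_iff_mem_periodicPts.1 (by omega)
  have hp : 0 < Function.minimalPeriod F w := by omega
  have := (Function.iterate_eq_iterate_iff_of_lt_minimalPeriod
    (f := F) (x := w) (m := a) (n := b) ha hb).1 ?_
  · exact this
  · have h2 := congrArg (F^[Function.minimalPeriod F w - 1]) hab
    rw [← Function.iterate_add_apply, ← Function.iterate_add_apply,
      show Function.minimalPeriod F w - 1 + (a + 1) = a + Function.minimalPeriod F w by omega,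
      show Function.minimalPeriod F w - 1 + (b + 1) = b + Function.minimalPeriod F w by omega,
      Function.iterate_add_apply, Function.iterate_add_apply, Function.iterate_minimalPeriod] at h2
    exact h2

lemma orb_head (hw : w ∈ Function.periodicPts F) : (orb F w).head? = some (F w) := by
  have := Function.minimalPeriod_pos_of_mem_periodicPts hw
  unfold orb
  obtain ⟨k, hk⟩ := Nat.exists_eq_succ_of_ne_zero this.ne'
  rw [hk, List.range_succ_eq_map]
  simp

lemma orb_last (hw : w ∈ Function.periodicPts F) : (orb F w).getLast? = some w := by
  have := Function.minimalPeriod_pos_of_mem_periodicPts hw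
  have h2 := Function.iterate_minimalPeriod (f := F) (x := w)
  unfold orb
  obtain ⟨k, hk⟩ := Nat.exists_eq_succ_of_ne_zero this.ne'
  rw [hk] at h2
  rw [hk, List.range_succ]
  simpa using h2

lemma mem_orb (hw : w ∈ Function.periodicPts F) (z : W) : z ∈ orb F w ↔ ∃ k, F^[k] w = z := by
  have hp := Function.minimalPeriod_pos_of_mem_periodicPts hw
  unfold orb
  simp only [List.mem_map, List.mem_range]
  constructor
  · rintro ⟨k, _, h⟩; exact ⟨k + 1, h⟩
  · rintro ⟨k, rfl⟩
    set N := Function.minimalPeriod F w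
    refine ⟨(k + (N - 1)) % N, Nat.mod_lt _ hp, ?_⟩
    rw [Function.iterate_succ_apply', Function.iterate_mod_minimalPeriod_eq,
      ← Function.iterate_succ_apply' F, show (k + (N - 1)).succ = k + N by omega,
      Function.iterate_add_apply, Function.iterate_minimalPeriod]

/-- The list obtained by cutting the orbit between the two copies of `z`. -/
lemma cut_list {r : W × Bool → W × Bool → Prop} (hs : ∀ {a b}, r a b → r b a)
    (hw : w ∈ Function.periodicPts F) (z : W)
    (hz : z ∈ orb F w) (h1 : ∀ z ∈ orb F w, r (z, true) (z, false))
    (h2 : ∀ z ∈ orb F w, r (z, false) (F z, true)) (hr : r (F w, true) (z, false)) :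
    ∃ R : List (W × Bool), R.Nodup ∧ (∀ p, p ∈ R ↔ p.1 ∈ orb F w) ∧ R.IsChain r ∧
      R.head? = some (z, true) ∧ R.getLast? = some (w, false) ∧
      ∀ y ∈ orb F w, y ≠ w → Near R (y, false) (F y, true) := by
  obtain ⟨A, B, hAB⟩ := List.append_of_mem hz
  have hD : dbl (orb F w) = (dbl A ++ [(z, true)]) ++ ((z, false) :: dbl B) := by rw [hAB]; simp
  have hch := chain_dbl (r := r) (orb F w) (orb_chain F w) h1 h2
  have hperm : ((dbl A ++ [(z, true)]).reverse ++ ((z, false) :: dbl B)).Perm (dbl (orb F w)) := by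
    rw [hD]
    exact List.Perm.append_right _ (List.reverse_perm _)
  have hhead : (dbl A ++ [(z, true)]).head? = some (F w, true) := by
    have := orb_head F w hw
    rw [hAB] at this
    cases A with
    | nil => simpa using this
    | cons c A => simpa using this
  have hlast : ((z, false) :: dbl B).getLast? = some (w, false) := by
    have := orb_last F w hw
    rw [hAB, List.getLast?_append] at this
    rcases List.eq_nil_or_concat B with rfl | ⟨B', c, rfl⟩
    · simpa using this
    · simp [List.getLast?_cons] at this
      simp [List.getLast?_cons, this]
  refine ⟨(dbl A ++ [(z, true)]).reverse ++ ((z, false) :: dbl B), ?_, ?_, ?_, ?_, ?_, ?_⟩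
  · exact hperm.nodup_iff.2 (nodup_dbl _ (orb_nodup F w))
  · intro p
    rw [hperm.mem_iff, mem_dbl]
  · rw [hD, List.isChain_append] at hch
    rw [List.isChain_append]
    refine ⟨?_, hch.2.1, ?_⟩
    · rw [List.isChain_reverse]; exact hch.1.imp fun a b => hs
    · intro a ha b hb
      rw [List.getLast?_reverse, hhead] at ha
      simp at ha hb
      subst ha hb
      exact hr
  · simp
  · rw [List.getLast?_append, hlast]; rfl
  · intro y hy hyw
    have hn := near_dbl (orb F w) (orb_chain F w) y hy
      (by rw [orb_last F w hw]; simpa using fun h => hyw h.symm)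
    have hn' : [(y, false), (F y, true)] <:+: dbl A ++ (z, true) :: (z, false) :: dbl B := by
      simpa [hD] using hn
    rcases pair_split hn' with h | h | h
    · exact (Near.reverse (Or.inl h)).mono ⟨[], (z, false) :: dbl B, by simp⟩
    · simp at h
    · exact Near.mono (Or.inl h) ⟨(dbl A ++ [(z, true)]).reverse, [], by simp⟩

end lists

/-! ### The main construction -/

open scoped Fin.NatCast Fin.CommRing in
lemma nxt_iter (n k : ℕ) (t : PT) (i : Fin (2 * n + 1)) :
    (nxt n)^[k] (t, i) = (rot^[k] t, i + (k : Fin (2 * n + 1))) := by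
  induction k with
  | zero => simp
  | succ k ih =>
    rw [Function.iterate_succ_apply', ih, Function.iterate_succ_apply' rot]
    simp [nxt, add_assoc]

lemma numNodes_iter (k : ℕ) (t : PT) : (rot^[k] t).numNodes = t.numNodes := by
  induction k with
  | zero => rfl
  | succ k ih => rw [Function.iterate_succ_apply', numNodes_rot, ih]

lemma rot_iter_mul (n k : ℕ) (t : PT) (ht : t.numNodes = n) : rot^[2 * n * k] t = t := by
  rw [Function.iterate_mul]
  have : rot^[2 * n] t = t := by rw [← ht]; exact rot_period t
  exact Function.iterate_fixed this k

open scoped Fin.NatCast Fin.CommRing in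
lemma nxt_periodic (n : ℕ) (hn : 1 ≤ n) (t : PT) (i : Fin (2 * n + 1)) (ht : t.numNodes = n) :
    (t, i) ∈ Function.periodicPts (nxt n) := by
  refine ⟨2 * n * (2 * n + 1), by positivity, ?_⟩
  unfold Function.IsPeriodicPt Function.IsFixedPt
  rw [nxt_iter, rot_iter_mul n _ t ht, Nat.cast_mul (2 * n) (2 * n + 1)]
  have : ((2 * n + 1 : ℕ) : Fin (2 * n + 1)) = 0 := by simp
  rw [this]
  simp

open scoped Fin.NatCast Fin.CommRing in
lemma mem_orb_nxt (n : ℕ) (hn : 1 ≤ n) (t : PT) (i : Fin (2 * n + 1)) (ht : t.numNodes = n)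
    (z : Sta n) : z ∈ orb (nxt n) (t, i) ↔ ∃ k, rot^[k] t = z.1 := by
  rw [mem_orb _ _ (nxt_periodic n hn t i ht)]
  constructor
  · rintro ⟨k, rfl⟩; exact ⟨k, by rw [nxt_iter]⟩
  · rintro ⟨k, hk⟩
    set s : Fin (2 * n + 1) := i + (k : Fin (2 * n + 1)) - z.2 with hs
    refine ⟨k + 2 * n * s.val, ?_⟩
    rw [nxt_iter, Function.iterate_add_apply, rot_iter_mul n _ t ht, hk]
    have h0 : ((2 * n + 1 : ℕ) : Fin (2 * n + 1)) = 0 := by simp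
    have h1 : ((2 * n : ℕ) : Fin (2 * n + 1)) = -1 := by
      rw [Nat.cast_add, Nat.cast_one] at h0
      exact eq_neg_of_add_eq_zero_left h0
    have h2 : i + ((k + 2 * n * s.val : ℕ) : Fin (2 * n + 1)) = z.2 := by
      rw [Nat.cast_add, Nat.cast_mul (2 * n), h1, Fin.cast_val_eq_self, hs]
      ring
    rw [h2]

/-- The state of the gluing process: a cycle (given as a path `l` whose ends are adjacent) through
all bitstrings belonging to a rotation-closed set `S` of trees. -/
structure GInv (n : ℕ) (S : Finset PT) (l : List (Sta n × Bool)) : Prop where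
  sub : ∀ t ∈ S, t.numNodes = n
  closed : ∀ t ∈ S, rot t ∈ S
  star : PT.star n ∈ S
  nodup : l.Nodup
  mem : ∀ p, p ∈ l ↔ p.1.1 ∈ S
  chain : l.IsChain (AdjS n)
  head : l.head? = some (nxt n (rot (PT.star n), 0), true)
  last : l.getLast? = some ((rot (PT.star n), 0), false)
  near : ∀ u v, nd em (nd u v) ∈ S → nd (nd em u) v ∉ S →
    Near l ((nd em (nd u v), 0), false) (nxt n (nd em (nd u v), 0), true)

lemma GInv.closed_iter {n : ℕ} {S : Finset PT} {l : List (Sta n × Bool)} (h : GInv n S l)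
    (k : ℕ) (t : PT) (ht : t ∈ S) : rot^[k] t ∈ S := by
  induction k with
  | zero => exact ht
  | succ k ih => rw [Function.iterate_succ_apply']; exact h.closed _ ih

lemma back_iter (n : ℕ) (hn : 1 ≤ n) (k : ℕ) (t : PT) (ht : t.numNodes = n) :
    rot^[2 * n * k - k] (rot^[k] t) = t := by
  rw [← Function.iterate_add_apply, Nat.sub_add_cancel (by nlinarith), rot_iter_mul n k t ht]

lemma ginv_base (n : ℕ) (hn : 1 ≤ n) : ∃ S l, GInv n S l := by
  classical
  set x := rot (PT.star n) with hx
  have hxn : x.numNodes = n := by rw [hx, numNodes_rot, numNodes_star]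
  have hp := nxt_periodic n hn x 0 hxn
  have hS : ∀ t, t ∈ ((orb (nxt n) (x, 0)).map Prod.fst).toFinset ↔ ∃ k, rot^[k] x = t := by
    intro t
    simp only [List.mem_toFinset, List.mem_map]
    constructor
    · rintro ⟨z, hz, rfl⟩
      exact (mem_orb_nxt n hn x 0 hxn z).1 hz
    · rintro ⟨k, hk⟩
      exact ⟨(t, 0), (mem_orb_nxt n hn x 0 hxn _).2 ⟨k, hk⟩, rfl⟩
  have hon : ∀ z ∈ orb (nxt n) (x, 0), z.1.numNodes = n := by
    intro z hz
    obtain ⟨k, hk⟩ := (mem_orb_nxt n hn x 0 hxn z).1 hz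
    rw [← hk, numNodes_iter, hxn]
  have hlast := orb_last (nxt n) (x, 0) hp
  refine ⟨((orb (nxt n) (x, 0)).map Prod.fst).toFinset, dbl (orb (nxt n) (x, 0)),
    ?_, ?_, ?_, nodup_dbl _ (orb_nodup _ _), ?_,
    chain_dbl _ (orb_chain _ _) (fun z hz => adj_one n z (hon z hz))
      (fun z hz => adj_two n hn z (hon z hz)), ?_, ?_, ?_⟩
  · intro t ht
    obtain ⟨k, rfl⟩ := (hS t).1 ht
    rw [numNodes_iter, hxn]
  · intro t ht
    obtain ⟨k, rfl⟩ := (hS t).1 ht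
    exact (hS _).2 ⟨k + 1, Function.iterate_succ_apply' _ _ _⟩
  · refine (hS _).2 ⟨2 * n * 1 - 1, ?_⟩
    exact back_iter n hn 1 (PT.star n) (numNodes_star n)
  · intro p
    rw [mem_dbl, hS, mem_orb_nxt n hn x 0 hxn]
  · have := orb_head (nxt n) (x, 0) hp
    cases h : orb (nxt n) (x, 0) with
    | nil => rw [h] at this; simp at this
    | cons c l => rw [h] at this; simpa using this
  · rcases List.eq_nil_or_concat (orb (nxt n) (x, 0)) with h | ⟨l, c, h⟩
    · rw [h] at hlast; simp at hlast
    · rw [h] at hlast ⊢; simpa using hlast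
  · intro u v hy _
    left
    refine near_dbl _ (orb_chain _ _) _ ((mem_orb_nxt n hn x 0 hxn _).2 ((hS _).1 hy)) ?_
    rw [hlast]
    intro h
    simp only [Option.some.injEq, Prod.mk.injEq, and_true] at h
    obtain ⟨m, rfl⟩ : ∃ m, n = m + 1 := ⟨n - 1, by omega⟩
    rw [hx, show PT.star (m + 1) = nd em (PT.star m) from rfl, rot_nd, em_app] at h
    simp at h

lemma ginv_step (n : ℕ) (hn : 1 ≤ n) (S : Finset PT) (l : List (Sta n × Bool)) (h : GInv n S l)
    (hne : ∃ t : PT, t.numNodes = n ∧ t ∉ S) : ∃ S' l', GInv n S' l' ∧ S.card < S'.card := by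
  classical
  obtain ⟨t0, ht0, ht0S⟩ := hne
  obtain ⟨t, ht, hmin⟩ := Finset.exists_min_image (BinaryTree.treesOfNumNodesEq n \ S) area
    ⟨t0, by simp [BinaryTree.mem_treesOfNumNodesEq, ht0, ht0S]⟩
  simp only [Finset.mem_sdiff, BinaryTree.mem_treesOfNumNodesEq] at ht hmin
  have harea : 0 < area t := by
    by_contra h0
    have := eq_star t (by omega)
    rw [ht.1] at this
    exact ht.2 (this ▸ h.star)
  obtain ⟨t', hpull⟩ := exists_pull t harea
  have ht' : t' ∈ S := by
    by_contra hc
    have := hmin t' ⟨by rw [hpull.numNodes, ht.1], hc⟩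
    have := hpull.area_lt
    omega
  obtain ⟨k, u, v, hx, hy⟩ := hpull.rotates em
  rw [app_em] at hx hy
  set x := nd (nd em u) v with hxdef
  set y := nd em (nd u v) with hydef
  have hyS : y ∈ S := by rw [← hy]; exact h.closed_iter k t' ht'
  have hxn : x.numNodes = n := by rw [← hx, numNodes_iter, ht.1]
  have hxk : ∀ j, rot^[j] x ∉ S := by
    intro j hj
    apply ht.2
    have h1 := h.closed_iter (2 * n * (j + k) - (j + k)) _ hj
    rw [← hx, ← Function.iterate_add_apply rot j, back_iter n hn (j + k) t ht.1] at h1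
    exact h1
  have hxS : x ∉ S := hxk 0
  have hp := nxt_periodic n hn x 0 hxn
  have hon : ∀ z ∈ orb (nxt n) (x, 0), z.1.numNodes = n := by
    intro z hz
    obtain ⟨k, hk⟩ := (mem_orb_nxt n hn x 0 hxn z).1 hz
    rw [← hk, numNodes_iter, hxn]
  obtain ⟨R, hR1, hR2, hR3, hR4, hR5, hR6⟩ := cut_list (nxt n) (x, 0) (r := AdjS n) AdjS.symm hp
    (nxt n (nxt n (nxt n (x, 0)))) ((mem_orb _ _ hp _).2 ⟨3, rfl⟩)
    (fun z hz => adj_one n z (hon z hz)) (fun z hz => adj_two n hn z (hon z hz))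
    (adj_bc n u v 0 hxn)
  obtain ⟨l', p1, p2, p3, p4, p5, p6⟩ := insert_list AdjS.symm h.chain hR3 hR4 hR5
    (adj_de n u v 0 hxn) (adj_ga n u v 0 hxn) (h.near u v hyS hxS)
  have hO : ∀ t, t ∈ ((orb (nxt n) (x, 0)).map Prod.fst).toFinset ↔ ∃ k, rot^[k] x = t := by
    intro t
    simp only [List.mem_toFinset, List.mem_map]
    constructor
    · rintro ⟨z, hz, rfl⟩
      exact (mem_orb_nxt n hn x 0 hxn z).1 hz
    · rintro ⟨k, hk⟩
      exact ⟨(t, 0), (mem_orb_nxt n hn x 0 hxn _).2 ⟨k, hk⟩, rfl⟩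
  set O := ((orb (nxt n) (x, 0)).map Prod.fst).toFinset with hOdef
  have hR2' : ∀ p, p ∈ R ↔ p.1.1 ∈ O := by
    intro p
    rw [hR2, hO, mem_orb_nxt n hn x 0 hxn]
  refine ⟨S ∪ O, l', ⟨?_, ?_, ?_, ?_, ?_, p2, ?_, ?_, ?_⟩, ?_⟩
  · intro t ht
    rcases Finset.mem_union.1 ht with ht | ht
    · exact h.sub t ht
    · obtain ⟨k, rfl⟩ := (hO t).1 ht
      rw [numNodes_iter, hxn]
  · intro t ht
    rcases Finset.mem_union.1 ht with ht | ht
    · exact Finset.mem_union_left _ (h.closed t ht)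
    · obtain ⟨k, rfl⟩ := (hO t).1 ht
      exact Finset.mem_union_right _ ((hO _).2 ⟨k + 1, Function.iterate_succ_apply' _ _ _⟩)
  · exact Finset.mem_union_left _ h.star
  · rw [p1.nodup_iff, List.nodup_append']
    refine ⟨h.nodup, hR1, ?_⟩
    intro p hp1 hp2
    rw [h.mem] at hp1
    rw [hR2', hO] at hp2
    obtain ⟨j, hj⟩ := hp2
    exact hxk j (hj ▸ hp1)
  · intro p
    rw [p1.mem_iff, List.mem_append, h.mem, hR2', Finset.mem_union]
  · rw [p3, h.head]
  · rw [p4, h.last]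
  · intro u' v' hy' hx'
    rw [Finset.mem_union, not_or] at hx'
    rcases Finset.mem_union.1 hy' with hy' | hy'
    · apply p5 _ _ (h.near u' v' hy' hx'.1)
      · intro he
        apply hx'.2
        rw [hO]
        refine ⟨0, ?_⟩
        simp only [hydef, Prod.mk.injEq, and_true] at he
        simp at he
        rw [he.1, he.2]
        rfl
      · intro he
        simp at he
    · apply p6
      apply hR6 _ ((mem_orb_nxt n hn x 0 hxn _).2 ((hO _).1 hy'))
      intro he
      simp only [Prod.mk.injEq, and_true, hxdef] at he
      simp at he
  · apply Finset.card_lt_card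
    refine ⟨Finset.subset_union_left, fun hc => hxS (hc (Finset.mem_union_right _ ((hO x).2 ⟨0, rfl⟩)))⟩

lemma ginv_all (n : ℕ) (hn : 1 ≤ n) : ∃ S l, GInv n S l ∧ ∀ t : PT, t.numNodes = n → t ∈ S := by
  have key : ∀ k : ℕ, ∃ S l, GInv n S l ∧ (k ≤ S.card ∨ ∀ t : PT, t.numNodes = n → t ∈ S) := by
    intro k
    induction k with
    | zero =>
      obtain ⟨S, l, h⟩ := ginv_base n hn
      exact ⟨S, l, h, Or.inl (Nat.zero_le _)⟩
    | succ k ih =>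
      obtain ⟨S, l, h, hk | hk⟩ := ih
      · by_cases hc : ∀ t : PT, t.numNodes = n → t ∈ S
        · exact ⟨S, l, h, Or.inr hc⟩
        · push Not at hc
          obtain ⟨S', l', h', hlt⟩ := ginv_step n hn S l h hc
          exact ⟨S', l', h', Or.inl (by omega)⟩
      · exact ⟨S, l, h, Or.inr hk⟩
  obtain ⟨S, l, h, hk | hk⟩ := key ((BinaryTree.treesOfNumNodesEq n).card + 1)
  · exfalso
    have : S ⊆ BinaryTree.treesOfNumNodesEq n := fun t ht =>
      BinaryTree.mem_treesOfNumNodesEq.2 (h.sub t ht)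
    have := Finset.card_le_card this
    omega
  · exact ⟨S, l, h, hk⟩

/-- A list through all vertices with consecutive vertices adjacent, and adjacent ends, gives a
Hamilton cycle. -/
lemma hamilton_of_list {V : Type*} [DecidableEq V] (G : SimpleGraph V) (L : List V) (hne : L ≠ [])
    (hnd : L.Nodup) (hall : ∀ v, v ∈ L) (hch : L.IsChain G.Adj)
    (hcl : G.Adj (L.getLast hne) (L.head hne)) (h3 : 3 ≤ L.length) :
    ∃ (v : V) (c : G.Walk v v), c.IsHamiltonianCycle := by
  refine ⟨L.getLast hne, SimpleGraph.Walk.cons hcl (SimpleGraph.Walk.ofSupport L hne hch), ?_⟩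
  have hsup := SimpleGraph.Walk.support_ofSupport hne hch
  have hpath : (SimpleGraph.Walk.ofSupport L hne hch).IsPath := by
    rw [SimpleGraph.Walk.isPath_def, hsup]; exact hnd
  rw [SimpleGraph.Walk.isHamiltonianCycle_iff_isCycle_and_support_count_tail_eq_one]
  constructor
  · rw [SimpleGraph.Walk.cons_isCycle_iff]
    refine ⟨hpath, fun he => ?_⟩
    rw [Sym2.eq_swap] at he
    have := hpath.length_eq_one_of_mem_edges he
    rw [SimpleGraph.Walk.length_ofSupport] at this
    omega
  · intro a
    rw [SimpleGraph.Walk.support_cons, List.tail_cons, hsup]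
    exact List.count_eq_one_of_mem hnd (hall a)

/-- middle levels theorem: for all `n ≥ 1`, the subgraph of
`Q_{2n+1}` induced by all vertices with exactly `n` or `n+1` ones has a
Hamilton cycle. -/
theorem middle_levels_hamilton (n : ℕ) (hn : 1 ≤ n) :
    ∃ (v : middleLevels n)
      (c : ((cubeGraph (2 * n + 1)).induce (middleLevels n)).Walk v v),
      c.IsHamiltonianCycle := by
  obtain ⟨S, l, h, hall⟩ := ginv_all n hn
  have hsz : ∀ p ∈ l, p.1.1.numNodes = n := fun p hp => h.sub _ ((h.mem p).1 hp)
  set L : List (middleLevels n) := l.pmap (fun p hp => ⟨rea n p, rea_mem n p hp⟩) hsz with hL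
  have hlne : l ≠ [] := by
    intro h0
    have := h.head
    rw [h0] at this
    simp at this
  have hne : L ≠ [] := by simpa [hL] using hlne
  have hlen : L.length = l.length := by simp [hL]
  refine hamilton_of_list _ L hne ?_ ?_ ?_ ?_ ?_
  · refine h.nodup.pmap ?_
    intro p hp q hq he
    exact rea_inj n p q hp hq (congrArg Subtype.val he)
  · rintro ⟨y, hy⟩
    obtain ⟨p, hp, rfl⟩ := rea_surj n y hy
    rw [hL, List.mem_pmap]
    exact ⟨p, (h.mem p).2 (hall _ hp), rfl⟩
  · rw [List.isChain_iff_getElem]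
    intro i hi
    have := (List.isChain_iff_getElem.1 h.chain) i (by omega)
    simp only [hL, List.getElem_pmap]
    exact this
  · have h1 : (L.getLast hne).val = rea n ((rot (PT.star n), 0), false) := by
      have := h.last
      rw [List.getLast?_eq_some_getLast hlne, Option.some.injEq] at this
      simp only [hL, List.getLast_pmap, this]
    have h2 : (L.head hne).val = rea n (nxt n (rot (PT.star n), 0), true) := by
      have := h.head
      rw [List.head?_eq_some_head hlne, Option.some.injEq] at this
      simp only [hL, List.head_pmap, this]
    change (cubeGraph (2 * n + 1)).Adj (L.getLast hne).val (L.head hne).val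
    rw [h1, h2]
    exact adj_two n hn (rot (PT.star n), 0) (by rw [numNodes_rot, numNodes_star])
  · rw [hlen]
    set f : Fin (2 * n + 1) → Sta n × Bool := fun i => ((PT.star n, i), true) with hf
    have hsub : (List.ofFn f) ⊆ l := by
      intro p hp
      rw [List.mem_ofFn] at hp
      obtain ⟨i, rfl⟩ := hp
      exact (h.mem _).2 h.star
    have hnd : (List.ofFn f).Nodup := by
      rw [List.nodup_ofFn]
      intro i j hij
      simpa [hf] using hij
    have := (hnd.subperm hsub).length_le
    rw [List.length_ofFn] at this
    omega
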